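/- Let Ω ⊆ ℂ be open connected with Ω ≠ ℂ. Then the set of non-extendable functions is a dense G_δ subset of H(Ω) with the topology of locally uniform convergence. -/

import Mathlib

open Metric Set

open Classical in
/-- The extension by zero of a continuous function on `Ω` to all of `ℂ`. -/
noncomputable def extendByZero (Ω : Set ℂ) (g : C(Ω, ℂ)) : ℂ → ℂ :=
  fun z => if h : z ∈ Ω then g ⟨z, h⟩ else 0

/-- `f` is extendable in the sense of Riemann domains from the planar domain `Ω`. -/
def ExtendableRiemannC (Ω : Set ℂ) (f : ℂ → ℂ) : Prop :=
  ∃ (c₁ c₂ : ℂ) (r₁ r₂ : ℝ), 0 < r₁ ∧ 0 < r₂ ∧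
    closedBall c₁ r₁ ⊆ ball c₂ r₂ ∩ Ω ∧
    (ball c₂ r₂ ∩ Ω).Nonempty ∧ (ball c₂ r₂ ∩ Ωᶜ).Nonempty ∧
    ∃ (F : ℂ → ℂ) (M : ℝ), DifferentiableOn ℂ F (ball c₂ r₂) ∧
      (∀ z ∈ ball c₂ r₂, ‖F z‖ ≤ M) ∧ EqOn F f (ball c₁ r₁)

open Filter Topology TopologicalSpace

lemma extendByZero_of_mem {Ω : Set ℂ} (g : C(Ω, ℂ)) {z : ℂ} (hz : z ∈ Ω) :
    extendByZero Ω g z = g ⟨z, hz⟩ := by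
  simp [extendByZero, hz]

/-- **Montel's theorem** along an ultrafilter: a uniformly bounded family of holomorphic functions
on an open set converges pointwise to a holomorphic function. -/
lemma exists_differentiableOn_tendsto_of_ultrafilter {ι : Type*} (U : Ultrafilter ι)
    {F : ι → ℂ → ℂ} {V : Set ℂ} (hV : IsOpen V) {M : ℝ}
    (hF : ∀ᶠ i in U, DifferentiableOn ℂ (F i) V ∧ ∀ z ∈ V, ‖F i z‖ ≤ M) :
    ∃ G : ℂ → ℂ, DifferentiableOn ℂ G V ∧
      ∀ z ∈ V, Tendsto (fun i => F i z) U (𝓝 (G z)) := by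
  have hlim : ∀ z, ∃ w, z ∈ V → Tendsto (fun i => F i z) U (𝓝 w) := by
    intro z
    by_cases hz : z ∈ V
    · obtain ⟨w, -, hw⟩ := (isCompact_closedBall (0 : ℂ) M).ultrafilter_le_nhds
        (U.map fun i => F i z) (by
          rw [le_principal_iff, Ultrafilter.coe_map, Filter.mem_map]
          filter_upwards [hF] with i hi
          simpa using hi.2 z hz)
      exact ⟨w, fun _ => hw⟩
    · exact ⟨0, fun h => absurd h hz⟩
  choose G hG using hlim
  refine ⟨G, ?_, hG⟩
  refine TendstoLocallyUniformlyOn.differentiableOn (F := F) (φ := U) ?_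
    (hF.mono fun _ h => h.1) hV
  rw [Metric.tendstoLocallyUniformlyOn_iff]
  intro ε hε x hx
  obtain ⟨r, hr, hrV⟩ := Metric.isOpen_iff.1 hV x hx
  have hM : 0 ≤ M := by
    obtain ⟨i, hi⟩ := hF.exists
    exact (norm_nonneg _).trans (hi.2 x hx)
  have hlip : ∀ᶠ i in U, ∀ y ∈ ball x r, dist (F i y) (F i x) ≤ 2 * M / r * dist y x := by
    filter_upwards [hF] with i hi y hy
    refine Complex.dist_le_div_mul_dist_of_mapsTo_ball (hi.1.mono hrV) (fun w hw => ?_) hy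
    rw [mem_closedBall, dist_eq_norm]
    linarith [norm_sub_le (F i w) (F i x), hi.2 w (hrV hw), hi.2 x hx]
  have hlipG : ∀ y ∈ ball x r, dist (G y) (G x) ≤ 2 * M / r * dist y x := fun y hy =>
    le_of_tendsto ((hG y (hrV hy)).dist (hG x hx)) (hlip.mono fun i hi => hi y hy)
  have hsmall : ∀ᶠ y in 𝓝 x, 2 * M / r * dist y x < ε / 3 := by
    have : Tendsto (fun y => 2 * M / r * dist y x) (𝓝 x) (𝓝 (2 * M / r * dist x x)) :=
      Continuous.tendsto (by fun_prop) x
    exact this.eventually_lt_const (by simpa using by positivity)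
  refine ⟨_, mem_nhdsWithin_of_mem_nhds (inter_mem hsmall (ball_mem_nhds x hr)), ?_⟩
  filter_upwards [hlip, Metric.tendsto_nhds.1 (hG x hx) (ε / 3) (by positivity)] with i hi hix
  rintro y ⟨hy : 2 * M / r * dist y x < ε / 3, hyr⟩
  have h₁ := hi y hyr
  have h₂ := hlipG y hyr
  have h₃ := dist_triangle4 (G y) (G x) (F i x) (F i y)
  rw [dist_comm (G x), dist_comm (F i x) (F i y)] at h₃
  linarith

/-- The space `H(Ω)` of holomorphic functions, as a subtype of `C(Ω, ℂ)`. -/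
abbrev HolomorphicMap (Ω : Set ℂ) : Type :=
  {g : C(Ω, ℂ) // DifferentiableOn ℂ (extendByZero Ω g) Ω}

lemma isClosed_setOf_differentiableOn_extendByZero {Ω : Set ℂ} (hΩ : IsOpen Ω) :
    IsClosed {g : C(Ω, ℂ) | DifferentiableOn ℂ (extendByZero Ω g) Ω} := by
  have := hΩ.locallyCompactSpace
  rw [isClosed_iff_ultrafilter]
  intro g U hU hmem
  refine TendstoLocallyUniformlyOn.differentiableOn (F := fun h : C(Ω, ℂ) => extendByZero Ω h)
    (φ := (U : Filter C(Ω, ℂ))) ?_ hmem hΩ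
  rw [tendstoLocallyUniformlyOn_iff_tendstoLocallyUniformly_comp_coe]
  have h := ContinuousMap.tendsto_iff_tendstoLocallyUniformly.1 (tendsto_id'.2 hU)
  have hcoe : ∀ (h : C(Ω, ℂ)) (z : Ω), extendByZero Ω h z = h z := fun h z =>
    extendByZero_of_mem h z.2
  simpa only [Function.comp_def, hcoe] using! h

lemma HolomorphicMap.baireSpace {Ω : Set ℂ} (hΩ : IsOpen Ω) : BaireSpace (HolomorphicMap Ω) := by
  have := hΩ.locallyCompactSpace
  have : IsCompletelyPseudoMetrizableSpace (HolomorphicMap Ω) :=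
    (isClosed_setOf_differentiableOn_extendByZero hΩ).isCompletelyPseudoMetrizableSpace
  infer_instance

/-- The holomorphic functions on `Ω` whose restriction to `ball c₁ r₁` extends to a holomorphic
function on `ball c₂ r₂` bounded by `M`. -/
def boundedlyExtendable (Ω : Set ℂ) (c₁ c₂ : ℂ) (r₁ r₂ M : ℝ) : Set (HolomorphicMap Ω) :=
  {f | ∃ F : ℂ → ℂ, DifferentiableOn ℂ F (ball c₂ r₂) ∧ (∀ z ∈ ball c₂ r₂, ‖F z‖ ≤ M) ∧
    EqOn F (extendByZero Ω f.1) (ball c₁ r₁)}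

section BoundedlyExtendable

variable {Ω : Set ℂ} {c₁ c₂ : ℂ} {r₁ r₂ M : ℝ}

lemma isClosed_boundedlyExtendable (h₂ : ball c₁ r₁ ⊆ ball c₂ r₂) (hΩ : ball c₁ r₁ ⊆ Ω) :
    IsClosed (boundedlyExtendable Ω c₁ c₂ r₁ r₂ M) := by
  rw [isClosed_iff_ultrafilter]
  intro f U hU hmem
  have hex : ∀ g : HolomorphicMap Ω, ∃ F : ℂ → ℂ, g ∈ boundedlyExtendable Ω c₁ c₂ r₁ r₂ M →
      DifferentiableOn ℂ F (ball c₂ r₂) ∧ (∀ z ∈ ball c₂ r₂, ‖F z‖ ≤ M) ∧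
        EqOn F (extendByZero Ω g.1) (ball c₁ r₁) := by
    intro g
    by_cases hg : g ∈ boundedlyExtendable Ω c₁ c₂ r₁ r₂ M
    · exact hg.imp fun F hF _ => hF
    · exact ⟨0, fun h => absurd h hg⟩
  choose F hF using hex
  have hev : ∀ᶠ g in (U : Filter (HolomorphicMap Ω)),
      g ∈ boundedlyExtendable Ω c₁ c₂ r₁ r₂ M := hmem
  obtain ⟨G, hGd, hG⟩ := exists_differentiableOn_tendsto_of_ultrafilter U (F := F) (M := M)
    (V := ball c₂ r₂) isOpen_ball (hev.mono fun g hg => ⟨(hF g hg).1, (hF g hg).2.1⟩)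
  refine ⟨G, hGd, fun z hz => le_of_tendsto (hG z hz).norm
    (hev.mono fun g hg => (hF g hg).2.1 z hz), fun z hz => ?_⟩
  refine tendsto_nhds_unique (hG z (h₂ hz)) ?_
  have hcont : Continuous fun g : HolomorphicMap Ω => g.1 ⟨z, hΩ hz⟩ :=
    (continuous_eval_const (F := C(Ω, ℂ)) _).comp continuous_subtype_val
  rw [extendByZero_of_mem _ (hΩ hz)]
  refine ((hcont.tendsto f).mono_left hU).congr' (hev.mono fun g hg => ?_)
  exact ((hF g hg).2.2 hz |>.trans (extendByZero_of_mem _ (hΩ hz))).symm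

/-- If `H` is holomorphic on a ball, it cannot coincide with the Cauchy kernel with pole in this ball
on a smaller one. -/
lemma not_eqOn_inv_sub {H : ℂ → ℂ} {ζ : ℂ} (hH : DifferentiableOn ℂ H (ball c₂ r₂))
    (hr₁ : 0 < r₁) (h₂ : ball c₁ r₁ ⊆ ball c₂ r₂) (hζ : ζ ∈ ball c₂ r₂) (hζ₁ : ζ ∉ ball c₁ r₁) :
    ¬ EqOn H (fun z => (z - ζ)⁻¹) (ball c₁ r₁) := by
  intro h
  have hd : DifferentiableOn ℂ (fun z => H z * (z - ζ)) (ball c₂ r₂) :=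
    hH.mul (by fun_prop)
  have heq : (fun z => H z * (z - ζ)) =ᶠ[𝓝 c₁] fun _ => 1 := by
    filter_upwards [ball_mem_nhds c₁ hr₁] with z hz
    have : z - ζ ≠ 0 := sub_ne_zero.2 fun hzζ => hζ₁ (hzζ ▸ hz)
    rw [h hz, inv_mul_cancel₀ this]
  have := (hd.analyticOnNhd isOpen_ball).eqOn_of_preconnected_of_eventuallyEq
    analyticOnNhd_const (convex_ball c₂ r₂).isPreconnected (h₂ (mem_ball_self hr₁)) heq hζ
  simp at this

lemma interior_boundedlyExtendable_eq_empty (hr₁ : 0 < r₁) (h₂ : ball c₁ r₁ ⊆ ball c₂ r₂)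
    (hΩ : ball c₁ r₁ ⊆ Ω) (hne : (ball c₂ r₂ ∩ Ωᶜ).Nonempty) :
    interior (boundedlyExtendable Ω c₁ c₂ r₁ r₂ M) = ∅ := by
  obtain ⟨ζ, hζ, hζΩ⟩ := hne
  rw [eq_empty_iff_forall_notMem]
  intro f hf
  have hsub : ∀ z ∈ Ω, z - ζ ≠ 0 := fun z hz => sub_ne_zero.2 fun h => hζΩ (h ▸ hz)
  let k : C(Ω, ℂ) := ⟨fun z => (z - ζ)⁻¹, by
    exact Continuous.inv₀ (by fun_prop) fun z => hsub z z.2⟩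
  have hk : ∀ t : ℂ, ∀ z ∈ Ω, extendByZero Ω (f.1 + t • k) z =
      extendByZero Ω f.1 z + t * (z - ζ)⁻¹ := fun t z hz => by
    simp [extendByZero_of_mem _ hz, k]
  let p : ℂ → HolomorphicMap Ω := fun t => ⟨f.1 + t • k, by
    refine DifferentiableOn.congr (f.2.add (DifferentiableOn.const_mul ?_ t)) (hk t)
    exact DifferentiableOn.inv (by fun_prop) hsub⟩
  have hp : Continuous p := Continuous.subtype_mk (by fun_prop) _
  have hp0 : p 0 = f := Subtype.ext (by simp only [p]; rw [zero_smul ℂ k, add_zero])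
  have hev : ∀ᶠ t in 𝓝 (0 : ℂ), p t ∈ boundedlyExtendable Ω c₁ c₂ r₁ r₂ M :=
    hp.continuousAt.eventually_mem (by rw [hp0]; exact mem_interior_iff_mem_nhds.1 hf)
  obtain ⟨t, ⟨F₁, hF₁, -, he₁⟩, ht⟩ :=
    ((hev.filter_mono nhdsWithin_le_nhds).and (self_mem_nhdsWithin (s := {(0 : ℂ)}ᶜ))).exists
  obtain ⟨F₀, hF₀, -, he₀⟩ := interior_subset hf
  refine not_eqOn_inv_sub (H := fun z => t⁻¹ * (F₁ z - F₀ z)) ((hF₁.sub hF₀).const_mul _) hr₁ h₂ hζ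
    (fun h => hζΩ (hΩ h)) fun z hz => ?_
  have ht' : t ≠ 0 := ht
  simp only [he₁ hz, he₀ hz, p, hk t z (hΩ hz), add_sub_cancel_left]
  rw [inv_mul_cancel_left₀ ht']

end BoundedlyExtendable

/-- A pair of balls, the first compactly inside the second, can be shrunk to balls with centres in a
dense sequence and rational radii, keeping a given point in the second ball. -/
lemma exists_denseSeq_rat_balls {X : Type*} [PseudoMetricSpace X] [SeparableSpace X] [Nonempty X]
    {c₁ c₂ p : X} {r₁ r₂ : ℝ} (hr₁ : 0 < r₁) (hc : c₁ ∈ ball c₂ r₂) (hp : p ∈ ball c₂ r₂) :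
    ∃ (m n : ℕ) (s₁ s₂ : ℚ), (0 : ℝ) < s₁ ∧
      closedBall (denseSeq X m) s₁ ⊆ ball c₁ r₁ ∧
      closedBall (denseSeq X m) s₁ ⊆ ball (denseSeq X n) s₂ ∧
      ball (denseSeq X n) s₂ ⊆ ball c₂ r₂ ∧ p ∈ ball (denseSeq X n) s₂ := by
  rw [mem_ball] at hc hp
  obtain ⟨δ, hδ, hδ'⟩ := exists_between
    (show 0 < min (r₁ / 5) (min ((r₂ - dist c₁ c₂) / 5) ((r₂ - dist p c₂) / 5)) by
      simp only [lt_min_iff]; refine ⟨?_, ?_, ?_⟩ <;> linarith)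
  simp only [lt_min_iff] at hδ'
  obtain ⟨hδ₁, hδ₂, hδ₃⟩ := hδ'
  obtain ⟨m, hm⟩ := (denseRange_denseSeq X).exists_dist_lt c₁ hδ
  obtain ⟨n, hn⟩ := (denseRange_denseSeq X).exists_dist_lt c₂ hδ
  obtain ⟨s₁, hs₁, hs₁'⟩ := exists_rat_btwn hδ
  obtain ⟨s₂, hs₂, hs₂'⟩ := exists_rat_btwn (show r₂ - 2 * δ < r₂ - δ by linarith)
  refine ⟨m, n, s₁, s₂, hs₁, fun z hz => ?_, fun z hz => ?_, fun z hz => ?_, ?_⟩ <;>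
    simp only [mem_ball, mem_closedBall] at *
  · linarith [dist_triangle_right z c₁ (denseSeq X m)]
  · have := dist_triangle_right z c₁ (denseSeq X m)
    have := dist_triangle z c₁ (denseSeq X n)
    have := dist_triangle c₁ c₂ (denseSeq X n)
    linarith
  · linarith [dist_triangle_right z c₂ (denseSeq X n)]
  · linarith [dist_triangle p c₂ (denseSeq X n)]

/-- The extendable functions form the union of countably many closed sets with empty interior. -/
lemma exists_countable_iUnion_extendable (Ω : Set ℂ) :
    ∃ (ι : Type) (_ : Countable ι) (A : ι → Set (HolomorphicMap Ω)),
      (∀ i, IsClosed (A i)) ∧ (∀ i, interior (A i) = ∅) ∧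
      {f : HolomorphicMap Ω | ExtendableRiemannC Ω (extendByZero Ω f.1)} = ⋃ i, A i := by
  let c := denseSeq ℂ
  let ι := {i : ℕ × ℕ × ℚ × ℚ × ℕ // (0 : ℝ) < i.2.2.1 ∧
    closedBall (c i.1) i.2.2.1 ⊆ ball (c i.2.1) i.2.2.2.1 ∩ Ω ∧
    (ball (c i.2.1) i.2.2.2.1 ∩ Ωᶜ).Nonempty}
  refine ⟨ι, inferInstance, fun i => boundedlyExtendable Ω (c i.1.1) (c i.1.2.1) i.1.2.2.1
    i.1.2.2.2.1 i.1.2.2.2.2, fun i => ?_, fun i => ?_, ?_⟩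
  · have h := ball_subset_closedBall.trans i.2.2.1
    exact isClosed_boundedlyExtendable (h.trans inter_subset_left) (h.trans inter_subset_right)
  · have h := ball_subset_closedBall.trans i.2.2.1
    exact interior_boundedlyExtendable_eq_empty i.2.1 (h.trans inter_subset_left)
      (h.trans inter_subset_right) i.2.2.2
  · ext f
    rw [mem_iUnion]
    constructor
    · rintro ⟨c₁, c₂, r₁, r₂, hr₁, -, hsub, -, ⟨p, hp, hpΩ⟩, F, M, hF, hM, hEq⟩
      obtain ⟨m, n, s₁, s₂, hs₁, h₁, h₁₂, h₂, hp'⟩ :=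
        exists_denseSeq_rat_balls hr₁ (hsub (mem_closedBall_self hr₁.le)).1 hp
      obtain ⟨N, hN⟩ := exists_nat_ge M
      refine ⟨⟨(m, n, s₁, s₂, N), hs₁, subset_inter h₁₂ ?_, p, hp', hpΩ⟩, F, hF.mono h₂,
        fun z hz => (hM z (h₂ hz)).trans hN, hEq.mono (ball_subset_closedBall.trans h₁)⟩
      exact h₁.trans (ball_subset_closedBall.trans (hsub.trans inter_subset_right))
    · rintro ⟨⟨⟨m, n, s₁, s₂, N⟩, hs₁, hsub, hne⟩, F, hF, hM, hEq⟩
      exact ⟨c m, c n, s₁, s₂, hs₁, pos_of_mem_ball hne.some_mem.1, hsub,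
        ⟨c m, hsub (mem_closedBall_self hs₁.le)⟩, hne, F, N, hF, hM, hEq⟩

/-- With the compact-open (locally uniform convergence) topology on `H(Ω)`,
realized as the subtype of `C(Ω, ℂ)` of holomorphic elements, the
non-extendable functions form a dense `Gδ` subset. -/
theorem stmt17 (Ω : Set ℂ) (hΩo : IsOpen Ω) (hΩc : IsConnected Ω)
    (hne : Ω ≠ Set.univ) :
    Dense {f : {g : C(Ω, ℂ) // DifferentiableOn ℂ (extendByZero Ω g) Ω} |
      ¬ ExtendableRiemannC Ω (extendByZero Ω f.1)} ∧
    IsGδ {f : {g : C(Ω, ℂ) // DifferentiableOn ℂ (extendByZero Ω g) Ω} |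
      ¬ ExtendableRiemannC Ω (extendByZero Ω f.1)} := by
  have := HolomorphicMap.baireSpace hΩo
  obtain ⟨ι, _, A, hcl, hint, hA⟩ := exists_countable_iUnion_extendable Ω
  have heq : {f : HolomorphicMap Ω | ¬ ExtendableRiemannC Ω (extendByZero Ω f.1)} =
      ⋂ i, (A i)ᶜ := by
    rw [← compl_iUnion, ← hA]
    rfl
  rw [heq]
  exact ⟨dense_iInter_of_isOpen (fun i => (hcl i).isOpen_compl)
    fun i => interior_eq_empty_iff_dense_compl.1 (hint i),
    IsGδ.iInter_of_isOpen fun i => (hcl i).isOpen_compl⟩
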